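/- Let 𝒰 and 𝒴 be real separable Banach spaces, μ₀ a Borel probability measure on 𝒰, and let Φ : 𝒰 × 𝒴 → ℝ and, for each N ∈ ℕ, Φ_N : 𝒰 × 𝒴 → ℝ all satisfy (A0), (A1) and (A2) with the same functions M_{0,r}, M_{1,r}, M_{2,r} (independent of N). Suppose (A3) holds: there are Ψ : ℕ → [0,∞) and, for every r > 0, a Borel measurable M_{3,r} : [0,∞) → [0,∞) such that |Φ_N(u;y) − Φ(u;y)| ≤ exp(M_{3,r}(‖u‖))·Ψ(N) for all u ∈ 𝒰, all y with ‖y‖ < r, and all N. Let r > 0 be such that S_{1,3,r} := ∫_𝒰 exp(2·M_{3,r}(‖u‖) − M_{1,r}(‖u‖)) dμ₀(u) < ∞ and S_{1,r} := ∫_𝒰 exp(−M_{1,r}(‖u‖)) dμ₀(u) < ∞. For ‖y‖ < r let μ^y and μ^y_N be the posteriors with densities proportional to exp(−Φ(·;y)) and exp(−Φ_N(·;y)) with respect to μ₀. Then there exists a constant C, independent of N (but possibly depending on r, S_{1,3,r}, and the data in (A0)–(A3)), such that d_H(μ^y, μ^y_N) ≤ C·Ψ(N) for all N ∈ ℕ.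 -/

import Mathlib

open MeasureTheory

/-- The Hellinger distance between two measures, computed with respect to the dominating
measure `λ = μ + ν`: `d_H(μ,ν)² = ∫ (√(dμ/dλ) - √(dν/dλ))² dλ`. -/
noncomputable def hellingerDist {U : Type*} [MeasurableSpace U] (μ ν : Measure U) : ℝ :=
  Real.sqrt (∫ u, (Real.sqrt ((μ.rnDeriv (μ + ν) u).toReal) -
    Real.sqrt ((ν.rnDeriv (μ + ν) u).toReal)) ^ 2 ∂(μ + ν))

/-- The Bayesian posterior for prior `μ₀`, misfit `Φ` and data `y`: the measure with density
`exp(-Φ(u;y)) / Z(y)` with respect to `μ₀`, where `Z(y) = ∫ exp(-Φ(u;y)) dμ₀(u)`. -/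
noncomputable def posteriorMeasure {U Y : Type*} [MeasurableSpace U]
    (μ₀ : Measure U) (Φ : U → Y → ℝ) (y : Y) : Measure U :=
  μ₀.withDensity fun u =>
    ENNReal.ofReal (Real.exp (-Φ u y) / ∫ v, Real.exp (-Φ v y) ∂μ₀)

theorem hellingerDist_withDensity_ofReal {U : Type*} [MeasurableSpace U] (μ : Measure U)
    [SigmaFinite μ] {p q : U → ℝ} (hp : Measurable p) (hq : Measurable q)
    (hp0 : ∀ u, 0 < p u) (hq0 : ∀ u, 0 < q u) :
    hellingerDist (μ.withDensity fun u => ENNReal.ofReal (p u))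
      (μ.withDensity fun u => ENNReal.ofReal (q u)) =
      Real.sqrt (∫ u, (Real.sqrt (p u) - Real.sqrt (q u)) ^ 2 ∂μ) := by
  have hpq0 : ∀ u, 0 < p u + q u := fun u => add_pos (hp0 u) (hq0 u)
  have hsum : (μ.withDensity fun u => ENNReal.ofReal (p u)) +
      (μ.withDensity fun u => ENNReal.ofReal (q u)) =
      μ.withDensity fun u => ENNReal.ofReal (p u + q u) := by
    rw [← withDensity_add_left hp.ennreal_ofReal]
    congr 1 with u
    exact (ENNReal.ofReal_add (hp0 u).le (hq0 u).le).symm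
  have hpqm : Measurable fun u => ENNReal.ofReal (p u + q u) := (hp.add hq).ennreal_ofReal
  have hσ : SigmaFinite (μ.withDensity fun u => ENNReal.ofReal (p u + q u)) :=
    SigmaFinite.withDensity_ofReal _
  have hrn : ∀ s : U → ℝ, Measurable s →
      (μ.withDensity fun u => ENNReal.ofReal (s u)).rnDeriv
        (μ.withDensity fun u => ENNReal.ofReal (p u + q u))
        =ᵐ[μ.withDensity fun u => ENNReal.ofReal (p u + q u)]
        fun u => ENNReal.ofReal (s u / (p u + q u)) := by
    intro s hs
    have hdiv : Measurable fun u => ENNReal.ofReal (s u / (p u + q u)) :=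
      (hs.div (hp.add hq)).ennreal_ofReal
    have h : (μ.withDensity fun u => ENNReal.ofReal (s u)) =
        (μ.withDensity fun u => ENNReal.ofReal (p u + q u)).withDensity
          fun u => ENNReal.ofReal (s u / (p u + q u)) := by
      rw [← withDensity_mul _ hpqm hdiv]
      congr 1 with u
      rw [Pi.mul_apply, ← ENNReal.ofReal_mul (hpq0 u).le, mul_div_cancel₀ _ (hpq0 u).ne']
    rw [h]
    exact Measure.rnDeriv_withDensity _ hdiv
  unfold hellingerDist
  rw [hsum]
  congr 1
  have hint : (∫ u, (Real.sqrt (((μ.withDensity fun u => ENNReal.ofReal (p u)).rnDeriv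
        (μ.withDensity fun u => ENNReal.ofReal (p u + q u)) u).toReal) -
      Real.sqrt (((μ.withDensity fun u => ENNReal.ofReal (q u)).rnDeriv
        (μ.withDensity fun u => ENNReal.ofReal (p u + q u)) u).toReal)) ^ 2
        ∂(μ.withDensity fun u => ENNReal.ofReal (p u + q u))) =
      ∫ u, (Real.sqrt (p u / (p u + q u)) - Real.sqrt (q u / (p u + q u))) ^ 2
        ∂(μ.withDensity fun u => ENNReal.ofReal (p u + q u)) := by
    refine integral_congr_ae ?_
    filter_upwards [hrn p hp, hrn q hq] with u h1 h2
    rw [h1, h2, ENNReal.toReal_ofReal (div_pos (hp0 u) (hpq0 u)).le,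
      ENNReal.toReal_ofReal (div_pos (hq0 u) (hpq0 u)).le]
  rw [hint, integral_withDensity_eq_integral_toReal_smul hpqm
    (Filter.Eventually.of_forall fun _ => ENNReal.ofReal_lt_top)]
  refine integral_congr_ae (Filter.Eventually.of_forall fun u => ?_)
  have h := hpq0 u
  simp only [smul_eq_mul]
  rw [ENNReal.toReal_ofReal h.le, Real.sqrt_div (hp0 u).le, Real.sqrt_div (hq0 u).le,
    ← sub_div, div_pow, Real.sq_sqrt h.le, mul_div_cancel₀ _ h.ne']

theorem abs_exp_neg_sub_exp_neg_le {m x y : ℝ} (hx : m ≤ x) (hy : m ≤ y) :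
    |Real.exp (-x) - Real.exp (-y)| ≤ Real.exp (-m) * |x - y| := by
  wlog h : x ≤ y generalizing x y
  · rw [abs_sub_comm, abs_sub_comm x]
    exact this hy hx (le_of_not_ge h)
  have hexp : Real.exp (-y) = Real.exp (-x) * Real.exp (-(y - x)) := by
    rw [← Real.exp_add]
    congr 1
    ring
  have hle := Real.add_one_le_exp (-(y - x))
  have hxm : Real.exp (-x) ≤ Real.exp (-m) := Real.exp_le_exp.2 (by linarith)
  rw [abs_of_nonneg (sub_nonneg.2 (Real.exp_le_exp.2 (by linarith))), abs_sub_comm,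
    abs_of_nonneg (sub_nonneg.2 h)]
  calc Real.exp (-x) - Real.exp (-y) = Real.exp (-x) * (1 - Real.exp (-(y - x))) := by
        rw [hexp]; ring
    _ ≤ Real.exp (-x) * (y - x) :=
        mul_le_mul_of_nonneg_left (by linarith) (Real.exp_pos _).le
    _ ≤ Real.exp (-m) * (y - x) := mul_le_mul_of_nonneg_right hxm (sub_nonneg.2 h)

theorem sq_sqrt_exp_neg_sub_le {m x y : ℝ} (hx : m ≤ x) (hy : m ≤ y) :
    (Real.sqrt (Real.exp (-x)) - Real.sqrt (Real.exp (-y))) ^ 2 ≤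
      Real.exp (-m) * (x - y) ^ 2 / 4 := by
  have h := abs_exp_neg_sub_exp_neg_le (m := m / 2) (x := x / 2) (y := y / 2)
    (by linarith) (by linarith)
  rw [← Real.exp_half, ← Real.exp_half, neg_div, neg_div, ← sq_abs]
  calc |Real.exp (-(x / 2)) - Real.exp (-(y / 2))| ^ 2
      ≤ (Real.exp (-(m / 2)) * |x / 2 - y / 2|) ^ 2 := by gcongr
    _ = Real.exp (-m) * (x - y) ^ 2 / 4 := by
        rw [mul_pow, sq_abs, ← Real.exp_nat_mul]
        push_cast
        ring_nf

theorem sq_div_sub_div_le (a b s t : ℝ) :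
    (a / s - b / t) ^ 2 ≤ 2 * (a - b) ^ 2 / s ^ 2 + 2 * b ^ 2 * (1 / s - 1 / t) ^ 2 := by
  have h : a / s - b / t = (a - b) / s + b * (1 / s - 1 / t) := by ring
  have h2 : 2 * (a - b) ^ 2 / s ^ 2 + 2 * b ^ 2 * (1 / s - 1 / t) ^ 2 =
    2 * ((a - b) / s) ^ 2 + 2 * (b * (1 / s - 1 / t)) ^ 2 := by ring
  rw [h, h2]
  nlinarith [sq_nonneg ((a - b) / s - b * (1 / s - 1 / t))]

theorem mul_sq_one_div_sqrt_sub_le {z w : ℝ} (hz : 0 < z) (hw : 0 < w) :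
    w * (1 / Real.sqrt z - 1 / Real.sqrt w) ^ 2 ≤ (z - w) ^ 2 / z ^ 2 := by
  have hs := Real.sqrt_pos.2 hz
  have ht := Real.sqrt_pos.2 hw
  have hz' := Real.sq_sqrt hz.le
  have hw' := Real.sq_sqrt hw.le
  set s := Real.sqrt z
  set t := Real.sqrt w
  rw [← hz', ← hw']
  have h1 : t ^ 2 * (1 / s - 1 / t) ^ 2 = (s - t) ^ 2 * s ^ 2 / (s ^ 2) ^ 2 := by
    field_simp
    ring
  rw [h1]
  gcongr
  have h2 : (s ^ 2 - t ^ 2) ^ 2 = (s - t) ^ 2 * (s + t) ^ 2 := by ring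
  rw [h2]
  gcongr
  linarith

theorem hellingerDist_posteriorMeasure_le {U Y : Type*} [MeasurableSpace U]
    {μ : Measure U} [IsProbabilityMeasure μ] {Φ Φ' : U → Y → ℝ} {y : Y} {m k : U → ℝ}
    {c δ : ℝ} (hΦ : Measurable fun u => Φ u y) (hΦ' : Measurable fun u => Φ' u y)
    (hm : ∀ u, m u ≤ Φ u y) (hm' : ∀ u, m u ≤ Φ' u y) (hk : ∀ u, 0 ≤ k u) (hδ : 0 ≤ δ)
    (hdiff : ∀ u, |Φ' u y - Φ u y| ≤ Real.exp (k u) * δ)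
    (hint : Integrable (fun u => Real.exp (-(m u))) μ)
    (hint' : Integrable (fun u => Real.exp (2 * k u - m u)) μ)
    (hc : 0 < c) (hcZ : c ≤ ∫ u, Real.exp (-Φ u y) ∂μ) :
    hellingerDist (posteriorMeasure μ Φ y) (posteriorMeasure μ Φ' y) ≤
      Real.sqrt ((∫ u, Real.exp (2 * k u - m u) ∂μ) / (2 * c) +
        2 * (∫ u, Real.exp (2 * k u - m u) ∂μ) ^ 2 / c ^ 2) * δ := by
  have hintexp : ∀ F : U → Y → ℝ, (Measurable fun u => F u y) → (∀ u, m u ≤ F u y) →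
      Integrable (fun u => Real.exp (-F u y)) μ := fun F hF hmF =>
    hint.mono' hF.neg.exp.aestronglyMeasurable <| Filter.Eventually.of_forall fun u => by
      rw [Real.norm_eq_abs, Real.abs_exp]
      exact Real.exp_le_exp.2 (neg_le_neg (hmF u))
  have hf := hintexp Φ hΦ hm
  have hg := hintexp Φ' hΦ' hm'
  have hw : 0 < ∫ u, Real.exp (-Φ' u y) ∂μ := integral_exp_pos hg
  have hz := hc.trans_le hcZ
  have hS : 0 ≤ ∫ u, Real.exp (2 * k u - m u) ∂μ := integral_nonneg fun _ => (Real.exp_pos _).le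
  unfold posteriorMeasure
  rw [hellingerDist_withDensity_ofReal μ
    (p := fun u => Real.exp (-Φ u y) / ∫ v, Real.exp (-Φ v y) ∂μ)
    (q := fun u => Real.exp (-Φ' u y) / ∫ v, Real.exp (-Φ' v y) ∂μ)
    (hΦ.neg.exp.div_const _) (hΦ'.neg.exp.div_const _)
    (fun u => div_pos (Real.exp_pos _) hz) (fun u => div_pos (Real.exp_pos _) hw)]
  have hZ : |(∫ u, Real.exp (-Φ u y) ∂μ) - ∫ u, Real.exp (-Φ' u y) ∂μ| ≤
      (∫ u, Real.exp (2 * k u - m u) ∂μ) * δ := by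
    rw [← integral_sub hf hg, ← integral_mul_const]
    refine abs_integral_le_integral_abs.trans
      (integral_mono (hf.sub hg).abs (hint'.mul_const δ) fun u => ?_)
    calc |Real.exp (-Φ u y) - Real.exp (-Φ' u y)|
        ≤ Real.exp (-m u) * |Φ u y - Φ' u y| := abs_exp_neg_sub_exp_neg_le (hm u) (hm' u)
      _ ≤ Real.exp (-m u) * (Real.exp (k u) * δ) := by
          rw [abs_sub_comm]
          gcongr
          exact hdiff u
      _ = Real.exp (k u - m u) * δ := by
          rw [← mul_assoc, ← Real.exp_add]
          ring_nf
      _ ≤ Real.exp (2 * k u - m u) * δ := by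
          gcongr
          linarith [hk u]
  set S := ∫ u, Real.exp (2 * k u - m u) ∂μ with hSdef
  set z := ∫ u, Real.exp (-Φ u y) ∂μ
  set w := ∫ u, Real.exp (-Φ' u y) ∂μ with hwdef
  refine Real.sqrt_le_iff.2 ⟨by positivity, ?_⟩
  rw [mul_pow, Real.sq_sqrt (by positivity)]
  have hpt : ∀ u, (Real.sqrt (Real.exp (-Φ u y) / z) - Real.sqrt (Real.exp (-Φ' u y) / w)) ^ 2 ≤
      Real.exp (2 * k u - m u) * (δ ^ 2 / (2 * z)) +
        Real.exp (-Φ' u y) * (2 * (1 / Real.sqrt z - 1 / Real.sqrt w) ^ 2) := by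
    intro u
    rw [Real.sqrt_div (Real.exp_pos _).le, Real.sqrt_div (Real.exp_pos _).le]
    refine (sq_div_sub_div_le _ _ _ _).trans ?_
    rw [Real.sq_sqrt hz.le, Real.sq_sqrt (Real.exp_pos _).le]
    have hsq : (Φ u y - Φ' u y) ^ 2 ≤ (Real.exp (k u) * δ) ^ 2 := by
      rw [← sq_abs, abs_sub_comm]
      gcongr
      exact hdiff u
    have h : (Real.sqrt (Real.exp (-Φ u y)) - Real.sqrt (Real.exp (-Φ' u y))) ^ 2 ≤
        Real.exp (2 * k u - m u) * δ ^ 2 / 4 := by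
      refine (sq_sqrt_exp_neg_sub_le (hm u) (hm' u)).trans ?_
      calc Real.exp (-m u) * (Φ u y - Φ' u y) ^ 2 / 4
          ≤ Real.exp (-m u) * (Real.exp (k u) * δ) ^ 2 / 4 := by gcongr
        _ = Real.exp (2 * k u - m u) * δ ^ 2 / 4 := by
            rw [sub_eq_neg_add, Real.exp_add, mul_pow, ← Real.exp_nat_mul]
            push_cast
            ring
    refine add_le_add ?_ (le_of_eq (by ring))
    calc 2 * (Real.sqrt (Real.exp (-Φ u y)) - Real.sqrt (Real.exp (-Φ' u y))) ^ 2 / z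
        ≤ 2 * (Real.exp (2 * k u - m u) * δ ^ 2 / 4) / z := by gcongr
      _ = Real.exp (2 * k u - m u) * (δ ^ 2 / (2 * z)) := by ring
  calc ∫ u, (Real.sqrt (Real.exp (-Φ u y) / z) - Real.sqrt (Real.exp (-Φ' u y) / w)) ^ 2 ∂μ
      ≤ ∫ u, (Real.exp (2 * k u - m u) * (δ ^ 2 / (2 * z)) +
        Real.exp (-Φ' u y) * (2 * (1 / Real.sqrt z - 1 / Real.sqrt w) ^ 2)) ∂μ :=
        integral_mono_of_nonneg (Filter.Eventually.of_forall fun _ => sq_nonneg _)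
          ((hint'.mul_const _).add (hg.mul_const _)) (Filter.Eventually.of_forall hpt)
    _ = S * (δ ^ 2 / (2 * z)) + 2 * (w * (1 / Real.sqrt z - 1 / Real.sqrt w) ^ 2) := by
        rw [integral_add (hint'.mul_const _) (hg.mul_const _), integral_mul_const,
          integral_mul_const, ← hSdef, ← hwdef]
        ring
    _ ≤ S * (δ ^ 2 / (2 * c)) + 2 * ((S * δ) ^ 2 / c ^ 2) := by
        have h : (z - w) ^ 2 ≤ (S * δ) ^ 2 := by
          rw [← sq_abs]
          gcongr
        gcongr
        refine (mul_sq_one_div_sqrt_sub_le hz hw).trans ?_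
        gcongr
    _ = (S / (2 * c) + 2 * S ^ 2 / c ^ 2) * δ ^ 2 := by ring

theorem exists_pos_le_integral_exp_neg {U Y : Type*} [NormedAddCommGroup U] [MeasurableSpace U]
    [BorelSpace U] [NormedAddCommGroup Y] (μ : Measure U) [IsProbabilityMeasure μ]
    {Φ : U → Y → ℝ}
    (hbdd : ∀ r > (0 : ℝ), ∃ M : ℝ, ∀ u y, ‖u‖ < r → ‖y‖ < r → |Φ u y| ≤ M) (r : ℝ) :
    ∃ c > 0, ∀ y, ‖y‖ < r → Integrable (fun u => Real.exp (-Φ u y)) μ →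
      c ≤ ∫ u, Real.exp (-Φ u y) ∂μ := by
  obtain ⟨n, hn⟩ : ∃ n : ℕ, 0 < μ (Metric.ball 0 (n : ℝ)) := by
    by_contra! h
    have h0 : μ (⋃ n : ℕ, Metric.ball (0 : U) (n : ℝ)) = 0 :=
      measure_iUnion_null fun n => nonpos_iff_eq_zero.1 (h n)
    rw [Metric.iUnion_ball_nat, measure_univ] at h0
    exact one_ne_zero h0
  have hR : 0 < max (max (n : ℝ) r) 1 := lt_max_of_lt_right one_pos
  obtain ⟨M, hM⟩ := hbdd _ hR
  refine ⟨μ.real (Metric.ball 0 (n : ℝ)) * Real.exp (-M),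
    mul_pos (ENNReal.toReal_pos hn.ne' (measure_ne_top _ _)) (Real.exp_pos _),
    fun y hy hint => ?_⟩
  calc μ.real (Metric.ball 0 (n : ℝ)) * Real.exp (-M)
      = ∫ _ in Metric.ball (0 : U) (n : ℝ), Real.exp (-M) ∂μ := by
        rw [setIntegral_const, smul_eq_mul]
    _ ≤ ∫ u in Metric.ball (0 : U) (n : ℝ), Real.exp (-Φ u y) ∂μ := by
        refine setIntegral_mono_on (integrable_const _) hint.integrableOn
          Metric.isOpen_ball.measurableSet fun u hu => ?_
        have := hM u y
          ((mem_ball_zero_iff.1 hu).trans_le ((le_max_left _ _).trans (le_max_left _ _)))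
          (hy.trans_le ((le_max_right _ _).trans (le_max_left _ _)))
        exact Real.exp_le_exp.2 (neg_le_neg ((le_abs_self _).trans this))
    _ ≤ ∫ u, Real.exp (-Φ u y) ∂μ :=
        setIntegral_le_integral hint (Filter.Eventually.of_forall fun _ => (Real.exp_pos _).le)

/-- Well-posedness of the Bayesian posterior with respect to perturbations of the misfit:
if `Φ` and all `Φ_N` satisfy (A0)--(A2) with the same bounds, and (A3) holds with rate
`Ψ(N)`, then under the integrability conditions `S_{1,3,r} < ∞` and `S_{1,r} < ∞` the
Hellinger distance between the corresponding posteriors is bounded by `C Ψ(N)`,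
with `C` independent of `N`. -/
theorem posterior_lipschitz_in_likelihood
    {U Y : Type*}
    [NormedAddCommGroup U] [NormedSpace ℝ U] [CompleteSpace U]
    [TopologicalSpace.SeparableSpace U] [MeasurableSpace U] [BorelSpace U]
    [NormedAddCommGroup Y] [NormedSpace ℝ Y] [CompleteSpace Y]
    [TopologicalSpace.SeparableSpace Y]
    (μ₀ : Measure U) [IsProbabilityMeasure μ₀]
    (Φ : U → Y → ℝ) (Φapprox : ℕ → U → Y → ℝ)
    -- (A0) for Φ and all Φ_N
    (hA0cont : ∀ u, Continuous (Φ u))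
    (hA0meas : ∀ y, Measurable fun u => Φ u y)
    (hA0bdd : ∀ r > (0 : ℝ), ∃ M₀ : ℝ, ∀ u y, ‖u‖ < r → ‖y‖ < r → |Φ u y| ≤ M₀)
    (hA0contN : ∀ N u, Continuous (Φapprox N u))
    (hA0measN : ∀ N y, Measurable fun u => Φapprox N u y)
    (hA0bddN : ∀ r > (0 : ℝ), ∃ M₀ : ℝ, ∀ N u y, ‖u‖ < r → ‖y‖ < r → |Φapprox N u y| ≤ M₀)
    -- (A1) for Φ and all Φ_N, with the same M₁
    (M₁ : ℝ → ℝ → ℝ)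
    (hA1meas : ∀ r > (0 : ℝ), Measurable (M₁ r))
    (hA1 : ∀ r > (0 : ℝ), ∀ u y, ‖y‖ < r → M₁ r ‖u‖ ≤ Φ u y)
    (hA1N : ∀ r > (0 : ℝ), ∀ N u y, ‖y‖ < r → M₁ r ‖u‖ ≤ Φapprox N u y)
    -- (A2) for Φ and all Φ_N, with the same M₂
    (M₂ : ℝ → ℝ → ℝ)
    (hA2meas : ∀ r > (0 : ℝ), Measurable (M₂ r))
    (hA2nonneg : ∀ r > (0 : ℝ), ∀ t : ℝ, 0 ≤ M₂ r t)
    (hA2 : ∀ r > (0 : ℝ), ∀ u y₁ y₂, ‖y₁‖ < r → ‖y₂‖ < r →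
      |Φ u y₁ - Φ u y₂| ≤ Real.exp (M₂ r ‖u‖) * ‖y₁ - y₂‖)
    (hA2N : ∀ r > (0 : ℝ), ∀ N u y₁ y₂, ‖y₁‖ < r → ‖y₂‖ < r →
      |Φapprox N u y₁ - Φapprox N u y₂| ≤ Real.exp (M₂ r ‖u‖) * ‖y₁ - y₂‖)
    -- (A3)
    (Ψ : ℕ → ℝ) (hΨ : ∀ N, 0 ≤ Ψ N)
    (M₃ : ℝ → ℝ → ℝ)
    (hA3meas : ∀ r > (0 : ℝ), Measurable (M₃ r))
    (hA3nonneg : ∀ r > (0 : ℝ), ∀ t : ℝ, 0 ≤ M₃ r t)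
    (hA3 : ∀ r > (0 : ℝ), ∀ N u y, ‖y‖ < r →
      |Φapprox N u y - Φ u y| ≤ Real.exp (M₃ r ‖u‖) * Ψ N)
    -- integrability
    (r : ℝ) (hr : 0 < r)
    (hS13 : Integrable (fun u => Real.exp (2 * M₃ r ‖u‖ - M₁ r ‖u‖)) μ₀)
    (hS1 : Integrable (fun u => Real.exp (-(M₁ r ‖u‖))) μ₀) :
    ∃ C : ℝ, ∀ y : Y, ‖y‖ < r → ∀ N : ℕ,
      hellingerDist (posteriorMeasure μ₀ Φ y) (posteriorMeasure μ₀ (Φapprox N) y) ≤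
        C * Ψ N := by
  obtain ⟨c, hc, hcZ⟩ := exists_pos_le_integral_exp_neg μ₀ hA0bdd r
  refine ⟨_, fun y hy N => hellingerDist_posteriorMeasure_le (hA0meas y) (hA0measN N y)
    (fun u => hA1 r hr u y hy) (fun u => hA1N r hr N u y hy) (fun u => hA3nonneg r hr ‖u‖)
    (hΨ N) (fun u => hA3 r hr N u y hy) hS1 hS13 hc (hcZ y hy ?_)⟩
  refine hS1.mono' (hA0meas y).neg.exp.aestronglyMeasurable
    (Filter.Eventually.of_forall fun u => ?_)
  rw [Real.norm_eq_abs, Real.abs_exp]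
  exact Real.exp_le_exp.2 (neg_le_neg (hA1 r hr u y hy))
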